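/- Let ρ > 0, η > 0, μ² > 0, β ≥ 0 and f(y) = ρ·(η·exp(−β·y) + μ²)/y. Let x₁ ≤ x₂, Δ = x₂ − x₁, and C₁ ≤ C₂ with C₁ > 0 and Δ² ≤ C₂ − C₁. Then for every x ∈ ℝ, min(f((x₁ − x)² + C₁), f((x₂ − x)² + C₂)) ≤ f(C₂), and equality holds at x = x₂; i.e., placing the antenna at the user with the larger offset maximizes the minimum average SNR, with optimal value t* = ρ·(η·exp(−β·C₂) + μ²)/C₂. -/

import Mathlib

/-- The average SNR `y ↦ ρ (η exp (-β y) + μ²) / y` is antitone on the positive reals. -/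
theorem antitoneOn_averageSNR {ρ η μ2 β : ℝ} (hρ : 0 ≤ ρ) (hη : 0 ≤ η) (hμ : 0 ≤ μ2)
    (hβ : 0 ≤ β) :
    AntitoneOn (fun y : ℝ => ρ * (η * Real.exp (-β * y) + μ2) / y) (Set.Ioi 0) := by
  intro a ha b _ hab
  have ha' : 0 < a := ha
  have hexp : Real.exp (-β * b) ≤ Real.exp (-β * a) :=
    Real.exp_le_exp.mpr (mul_le_mul_of_nonpos_left hab (neg_nonpos.mpr hβ))
  dsimp only
  gcongr

/-- Closely-spaced case of Lemma 1: with `f(y) = ρ·(η·exp(−β·y) + μ²)/y` and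
`Δ² ≤ C₂ − C₁`, placing the antenna at `x₂` (the user with the larger offset)
maximizes the minimum average SNR, with optimal value `f(C₂)`. -/
theorem two_user_maxmin_closely_spaced (ρ η μ2 β x₁ x₂ C₁ C₂ : ℝ)
    (hρ : 0 < ρ) (hη : 0 < η) (hμ : 0 < μ2) (hβ : 0 ≤ β)
    (hx : x₁ ≤ x₂) (hC₁ : 0 < C₁) (hC : C₁ ≤ C₂)
    (hsep : (x₂ - x₁) ^ 2 ≤ C₂ - C₁)
    (f : ℝ → ℝ) (hf : ∀ y, f y = ρ * (η * Real.exp (-β * y) + μ2) / y) :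
    (∀ x : ℝ, min (f ((x₁ - x) ^ 2 + C₁)) (f ((x₂ - x) ^ 2 + C₂)) ≤ f C₂) ∧
    min (f ((x₁ - x₂) ^ 2 + C₁)) (f ((x₂ - x₂) ^ 2 + C₂)) = f C₂ ∧
    f C₂ = ρ * (η * Real.exp (-β * C₂) + μ2) / C₂ := by
  have hC₂ : 0 < C₂ := hC₁.trans_le hC
  have anti : ∀ a b, 0 < a → a ≤ b → f b ≤ f a := fun a b ha hab => by
    simpa only [hf] using
      antitoneOn_averageSNR hρ.le hη.le hμ.le hβ ha (ha.trans_le hab) hab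
  refine ⟨fun x => (min_le_right _ _).trans (anti _ _ hC₂ ?_), ?_, hf C₂⟩
  · exact le_add_of_nonneg_left (sq_nonneg _)
  · have h₂ : (x₂ - x₂) ^ 2 + C₂ = C₂ := by ring
    rw [h₂]
    exact min_eq_right (anti _ _ (by positivity) (by nlinarith))
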